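/- arXiv:2310.15641 — 5 statements merged into one kernel-verified Lean document; each statement's English description precedes it below -/
import Mathlib

section
/- Let Z be a measurable space, let n = l+1, and let Z_1, …, Z_n be random elements of Z defined on a probability space whose joint law is exchangeable (invariant under every permutation of the n coordinates). Let A be a measurable nonconformity measure, i.e., a measurable map taking a tuple of l elements of Z together with one further element of Z to a real number, which is invariant under every permutation of its first argument's l coordinates. For each i ∈ {1,…,n} define the nonconformity score α_i = A((Z_j)_{j≠i}, Z_i), where (Z_j)_{j≠i} denotes the remaining n−1 random elements (in any order). Then for every δ ∈ [0,1], with probability at least 1−δ the p-value p = |{i ∈ {1,…,n} : α_i ≥ α_n}| / n satisfies p > δ; equivalently, P(|{i : α_i ≥ α_n}| ≤ δ·n) ≤ δ. (This is the Conformal Prediction coverage guarantee: the conformal prediction region C^δ = {ỹ : p(ỹ) > δ} covers the true label with probability at least 1−δ.) -/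
open MeasureTheory

/-- The nonconformity score of the `i`-th entry of the tuple `z` relative to the other entries. -/
def nonconformityScore {𝓩 : Type*} {l : ℕ} (A : (Fin l → 𝓩) → 𝓩 → ℝ)
    (z : Fin (l + 1) → 𝓩) (i : Fin (l + 1)) : ℝ :=
  A (fun j => z (i.succAbove j)) (z i)

/-- The number of indices whose value under `a` is at least that of `k`. -/
noncomputable def upperRank {ι : Type*} [Fintype ι] (a : ι → ℝ) (k : ι) : ℕ :=
  (Finset.univ.filter (fun i => a k ≤ a i)).card

theorem exists_perm_apply_succAbove {l : ℕ} (π : Equiv.Perm (Fin (l + 1))) (i : Fin (l + 1)) :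
    ∃ σ : Equiv.Perm (Fin l), ∀ j, π (i.succAbove j) = (π i).succAbove (σ j) := by
  have hex : ∀ j, ∃ m, (π i).succAbove m = π (i.succAbove j) := fun j =>
    Fin.exists_succAbove_eq (π.injective.ne (Fin.succAbove_ne i j))
  choose f hf using hex
  have hinj : Function.Injective f := by
    intro a b hab
    have h : π (i.succAbove a) = π (i.succAbove b) := by rw [← hf, ← hf, hab]
    exact Fin.succAbove_right_injective (π.injective h)
  exact ⟨Equiv.ofBijective f (Finite.injective_iff_bijective.mp hinj), fun j => (hf j).symm⟩

theorem nonconformityScore_comp_perm {𝓩 : Type*} {l : ℕ} {A : (Fin l → 𝓩) → 𝓩 → ℝ}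
    (hA : ∀ (σ : Equiv.Perm (Fin l)) (zs : Fin l → 𝓩) (z : 𝓩), A (zs ∘ σ) z = A zs z)
    (π : Equiv.Perm (Fin (l + 1))) (z : Fin (l + 1) → 𝓩) :
    nonconformityScore A (z ∘ π) = nonconformityScore A z ∘ π := by
  funext i
  obtain ⟨σ, hσ⟩ := exists_perm_apply_succAbove π i
  simp only [nonconformityScore, Function.comp_apply, hσ]
  exact hA σ (fun j => z ((π i).succAbove j)) (z (π i))

theorem upperRank_comp_perm {ι : Type*} [Fintype ι] (a : ι → ℝ) (π : Equiv.Perm ι) (k : ι) :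
    upperRank (a ∘ π) k = upperRank a (π k) :=
  Finset.card_equiv π (by simp)

theorem card_upperRank_le {ι : Type*} [Fintype ι] (a : ι → ℝ) {c : ℝ} (hc : 0 ≤ c) :
    ((Finset.univ.filter (fun k => (upperRank a k : ℝ) ≤ c)).card : ℝ) ≤ c := by
  set T := Finset.univ.filter (fun k => (upperRank a k : ℝ) ≤ c) with hT
  rcases T.eq_empty_or_nonempty with h | h
  · simpa [h] using hc
  · obtain ⟨k, hk, hmin⟩ := T.exists_min_image a h
    have hsub : T.card ≤ upperRank a k :=
      Finset.card_le_card fun i hi => by simpa using hmin i hi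
    exact (Nat.cast_le.mpr hsub).trans (by simpa [hT] using hk)

theorem measurable_nonconformityScore {𝓩 : Type*} [MeasurableSpace 𝓩] {l : ℕ}
    {A : (Fin l → 𝓩) → 𝓩 → ℝ} (hA : Measurable (Function.uncurry A)) :
    Measurable (nonconformityScore A) := by
  refine measurable_pi_lambda _ fun i => ?_
  have h : Measurable (fun z : Fin (l + 1) → 𝓩 => ((fun j => z (i.succAbove j)), z i)) := by
    fun_prop
  exact hA.comp h

theorem measurable_upperRank {ι : Type*} [Fintype ι] (k : ι) :
    Measurable (fun a : ι → ℝ => upperRank a k) := by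
  simp only [upperRank, Finset.card_filter]
  exact Finset.measurable_sum _ fun i _ => Measurable.ite
    (measurableSet_le (measurable_pi_apply k) (measurable_pi_apply i))
    measurable_const measurable_const

/-- Conformal Prediction coverage guarantee: if the data `Z 0, …, Z l` are exchangeable
and the nonconformity measure `A` is invariant under permutations of its first argument,
then the conformal p-value `p = |{i : α i ≥ α (l+1)}| / (l+1)` satisfies
`P(p ≤ δ) ≤ δ` for every `δ ∈ [0,1]`. -/
theorem conformal_coverage
    {𝓩 : Type*} [MeasurableSpace 𝓩] {Ω : Type*} [MeasurableSpace Ω]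
    (P : Measure Ω) [IsProbabilityMeasure P]
    (l : ℕ) (Z : Fin (l + 1) → Ω → 𝓩) (hZmeas : ∀ i, Measurable (Z i))
    (hexch : ∀ π : Equiv.Perm (Fin (l + 1)),
      P.map (fun ω => fun i => Z (π i) ω) = P.map (fun ω => fun i => Z i ω))
    (A : (Fin l → 𝓩) → 𝓩 → ℝ)
    (hAmeas : Measurable (Function.uncurry A))
    (hAsym : ∀ (σ : Equiv.Perm (Fin l)) (zs : Fin l → 𝓩) (z : 𝓩), A (zs ∘ σ) z = A zs z)
    (α : Fin (l + 1) → Ω → ℝ)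
    (hα : ∀ i ω, α i ω = A (fun j => Z (i.succAbove j) ω) (Z i ω))
    (δ : ℝ) (hδ0 : 0 ≤ δ) (hδ1 : δ ≤ 1) :
    P {ω | ((Finset.univ.filter
        (fun i : Fin (l + 1) => α (Fin.last l) ω ≤ α i ω)).card : ℝ) ≤ δ * (l + 1)}
      ≤ ENNReal.ofReal δ := by
  set E : Fin (l + 1) → Set (Fin (l + 1) → 𝓩) :=
    fun k => {z | (upperRank (nonconformityScore A z) k : ℝ) ≤ δ * (l + 1)} with hE
  have hEmeas : ∀ k, MeasurableSet (E k) := fun k =>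
    measurableSet_le (measurable_from_top.comp
      ((measurable_upperRank k).comp (measurable_nonconformityScore hAmeas))) measurable_const
  have hZ : Measurable (fun ω i => Z i ω) := measurable_pi_lambda _ hZmeas
  set μ := P.map (fun ω i => Z i ω) with hμ
  have : IsProbabilityMeasure μ := Measure.isProbabilityMeasure_map hZ.aemeasurable
  have hgoal : {ω | ((Finset.univ.filter
      (fun i : Fin (l + 1) => α (Fin.last l) ω ≤ α i ω)).card : ℝ) ≤ δ * (l + 1)}
      = (fun ω i => Z i ω) ⁻¹' E (Fin.last l) := by
    ext ω
    simp [hE, upperRank, nonconformityScore, hα]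
  rw [hgoal, ← Measure.map_apply hZ (hEmeas _)]
  have hsame : ∀ k, μ (E k) = μ (E (Fin.last l)) := by
    intro k
    set π := Equiv.swap (Fin.last l) k
    have hπ : Measurable (fun ω i => Z (π i) ω) := measurable_pi_lambda _ fun i => hZmeas (π i)
    rw [hμ, Measure.map_apply hZ (hEmeas k), ← hμ, ← hexch π, Measure.map_apply hπ (hEmeas _)]
    congr 1
    ext ω
    have h := upperRank_comp_perm (nonconformityScore A (fun i => Z i ω)) π (Fin.last l)
    rw [← nonconformityScore_comp_perm hAsym, Equiv.swap_apply_left] at h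
    simp only [hE, Set.mem_preimage, Set.mem_ofPred_eq, ← h, Function.comp_def]
  have hsum : ∑ k, μ (E k) ≤ ENNReal.ofReal (δ * (l + 1)) := by
    calc ∑ k, μ (E k) = ∫⁻ z, ∑ k, (E k).indicator 1 z ∂μ := by
          rw [lintegral_finsetSum _ fun k _ => measurable_one.indicator (hEmeas k)]
          simp only [lintegral_indicator_one (hEmeas _)]
      _ ≤ ∫⁻ _, ENNReal.ofReal (δ * (l + 1)) ∂μ := by
          refine lintegral_mono fun z => ?_
          have hcard := card_upperRank_le (nonconformityScore A z)
            (c := δ * (l + 1)) (by positivity)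
          have := ENNReal.ofReal_le_ofReal hcard
          rw [ENNReal.ofReal_natCast, Finset.card_filter] at this
          simpa [hE, Set.indicator_apply] using this
      _ = ENNReal.ofReal (δ * (l + 1)) := by simp
  have hn : ENNReal.ofReal ((l : ℝ) + 1) = (l : ENNReal) + 1 := by
    exact_mod_cast ENNReal.ofReal_natCast (l + 1)
  simp only [hsame, Finset.sum_const, Finset.card_univ, Fintype.card_fin, nsmul_eq_mul,
    ENNReal.ofReal_mul hδ0, hn, Nat.cast_add, Nat.cast_one] at hsum
  rw [mul_comm] at hsum
  exact (ENNReal.mul_le_mul_iff_left (by simp) (by finiteness)).mp hsum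
end

section
/- Let (α_1, …, α_n) be an exchangeable random vector with values in ℝ^n, i.e., its joint law is invariant under every permutation of its coordinates. Then for every δ ∈ [0,1], P(|{i ∈ {1,…,n} : α_i ≥ α_n}| ≤ δ·n) ≤ δ. -/
open MeasureTheory

/-- At most `c` indices `j` satisfy `|{i : x_i ≥ x_j}| ≤ c`. -/
lemma card_filter_card_ge_le {ι : Type*} [Fintype ι] (x : ι → ℝ) {c : ℝ} (hc : 0 ≤ c) :
    ((Finset.univ.filter (fun j : ι =>
      ((Finset.univ.filter (fun i : ι => x j ≤ x i)).card : ℝ) ≤ c)).card : ℝ) ≤ c := by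
  set J := Finset.univ.filter (fun j : ι =>
      ((Finset.univ.filter (fun i : ι => x j ≤ x i)).card : ℝ) ≤ c)
  rcases J.eq_empty_or_nonempty with h | h
  · simpa [h] using hc
  · obtain ⟨j, hj, hmin⟩ := J.exists_min_image x h
    have hsub : J ⊆ Finset.univ.filter (fun i : ι => x j ≤ x i) := fun i hi => by
      simpa using hmin i hi
    exact (Nat.cast_le.mpr (Finset.card_le_card hsub)).trans (Finset.mem_filter.mp hj).2

lemma measurableSet_card_ge_le {ι : Type*} [Fintype ι] (j : ι) (c : ℝ) :
    MeasurableSet {x : ι → ℝ |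
      ((Finset.univ.filter (fun i : ι => x j ≤ x i)).card : ℝ) ≤ c} := by
  refine measurableSet_le ?_ measurable_const
  simp only [Finset.card_filter, Nat.cast_sum, Nat.cast_ite, Nat.cast_one, Nat.cast_zero]
  exact Finset.measurable_sum _ fun i _ => Measurable.ite
    (measurableSet_le (measurable_pi_apply j) (measurable_pi_apply i))
    measurable_const measurable_const

/-- The rank of coordinate `k` after permuting by `π` is the original rank of `π k`. -/
lemma card_ge_comp_perm {ι : Type*} [Fintype ι] (x : ι → ℝ) (π : Equiv.Perm ι) (k : ι) :
    (Finset.univ.filter (fun i : ι => (x ∘ π) k ≤ (x ∘ π) i)).card =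
      (Finset.univ.filter (fun i : ι => x (π k) ≤ x i)).card :=
  Finset.card_equiv π fun i => by simp

/-- For an exchangeable law `Q`, the event `|{i : x_i ≥ x_k}| ≤ c` has probability at most
`c / |ι|`. -/
lemma card_mul_measure_card_ge_le {ι : Type*} [Fintype ι] (Q : Measure (ι → ℝ))
    [IsProbabilityMeasure Q] (hQ : ∀ π : Equiv.Perm ι, Q.map (fun x => x ∘ π) = Q)
    (k : ι) {c : ℝ} (hc : 0 ≤ c) :
    Fintype.card ι * Q {x | ((Finset.univ.filter (fun i : ι => x k ≤ x i)).card : ℝ) ≤ c} ≤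
      ENNReal.ofReal c := by
  classical
  set S : ι → Set (ι → ℝ) := fun j =>
    {x | ((Finset.univ.filter (fun i : ι => x j ≤ x i)).card : ℝ) ≤ c} with hS
  have hSm : ∀ j, MeasurableSet (S j) := fun j => measurableSet_card_ge_le j c
  have hSk : ∀ j, Q (S j) = Q (S k) := fun j => by
    have hperm : Measurable fun x : ι → ℝ => x ∘ Equiv.swap k j :=
      measurable_pi_lambda _ fun i => measurable_pi_apply _
    conv_rhs => rw [← hQ (Equiv.swap k j), Measure.map_apply hperm (hSm k)]
    congr 1
    ext x
    simp only [hS, Set.mem_preimage, Set.mem_ofPred_eq, card_ge_comp_perm, Equiv.swap_apply_left]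
  calc Fintype.card ι * Q (S k) = ∑ j, Q (S j) := by simp [hSk]
    _ = ∑ j, ∫⁻ x, (S j).indicator 1 x ∂Q := by simp [lintegral_indicator_one (hSm _)]
    _ = ∫⁻ x, ∑ j, (S j).indicator 1 x ∂Q :=
      (lintegral_finsetSum _ fun j _ => measurable_one.indicator (hSm j)).symm
    _ ≤ ∫⁻ _, ENNReal.ofReal c ∂Q := lintegral_mono fun x => by
      have h := ENNReal.ofReal_le_ofReal (card_filter_card_ge_le x hc)
      rw [ENNReal.ofReal_natCast] at h
      simpa [Set.indicator_apply, hS, Finset.sum_boole] using h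
    _ = ENNReal.ofReal c := by simp

/-- For an exchangeable random vector `(α_1, …, α_n)` in `ℝ^n`, the conformal p-value
`p = |{i : α_i ≥ α_n}| / n` satisfies `P(|{i : α_i ≥ α_n}| ≤ δ·n) ≤ δ` for every `δ ∈ [0,1]`. -/
theorem exchangeable_pvalue_bound
    {Ω : Type*} [MeasurableSpace Ω] (P : Measure Ω) [IsProbabilityMeasure P]
    (n : ℕ) (hn : 0 < n) (α : Ω → Fin n → ℝ) (hmeas : Measurable α)
    (hexch : ∀ π : Equiv.Perm (Fin n), P.map (fun ω => α ω ∘ π) = P.map α)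
    (δ : ℝ) (hδ0 : 0 ≤ δ) (hδ1 : δ ≤ 1) :
    P {ω | ((Finset.univ.filter
        (fun i : Fin n => α ω ⟨n - 1, by omega⟩ ≤ α ω i)).card : ℝ) ≤ δ * n}
      ≤ ENNReal.ofReal δ := by
  have : IsProbabilityMeasure (P.map α) := Measure.isProbabilityMeasure_map hmeas.aemeasurable
  have hQ : ∀ π : Equiv.Perm (Fin n), (P.map α).map (fun x => x ∘ π) = P.map α := fun π => by
    have hperm : Measurable fun x : Fin n → ℝ => x ∘ π :=
      measurable_pi_lambda _ fun i => measurable_pi_apply _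
    rw [Measure.map_map hperm hmeas]
    exact hexch π
  have h := card_mul_measure_card_ge_le (P.map α) hQ ⟨n - 1, by omega⟩
    (c := δ * n) (by positivity)
  rw [Measure.map_apply hmeas (measurableSet_card_ge_le _ _), ENNReal.ofReal_mul hδ0,
    ENNReal.ofReal_natCast, Fintype.card_fin, mul_comm] at h
  exact (ENNReal.mul_le_mul_iff_left (by exact_mod_cast hn.ne') (ENNReal.natCast_ne_top n)).mp h
end

section
/- Let A be an n×n real symmetric positive definite matrix, let i ∈ {1,…,n}, and let y ∈ ℝ^n. Denote by A_{-i} the (n−1)×(n−1) matrix obtained from A by deleting its i-th row and i-th column, by a_i ∈ ℝ^{n−1} the i-th column of A with its i-th entry deleted, and by y_{-i} ∈ ℝ^{n−1} the vector y with its i-th entry deleted. Then A_{-i} is invertible, (A^{-1})_{ii} ≠ 0, and y_i − a_iᵀ · A_{-i}^{-1} · y_{-i} = (A^{-1}·y)_i / (A^{-1})_{ii}. -/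
open Matrix

/-- Off-diagonal part of the `i`-th row of `A⁻¹`, in terms of the block of `A` that avoids `i`. -/
theorem inv_row_succAbove {K : Type*} [Field K] {m : ℕ}
    {A : Matrix (Fin (m + 1)) (Fin (m + 1)) K} (hA : IsUnit A) (i : Fin (m + 1))
    (hB : IsUnit (A.submatrix i.succAbove i.succAbove)) :
    (fun j => A⁻¹ i (i.succAbove j)) =
      -(A⁻¹ i i • ((fun j => A i (i.succAbove j)) ᵥ*
        (A.submatrix i.succAbove i.succAbove)⁻¹)) := by
  have hdet := (isUnit_iff_isUnit_det _).mp hB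
  have hrow : (fun j => A⁻¹ i (i.succAbove j)) ᵥ* A.submatrix i.succAbove i.succAbove =
      -(A⁻¹ i i • fun j => A i (i.succAbove j)) := by
    funext j
    have h := congrFun (congrFun (nonsing_inv_mul A ((isUnit_iff_isUnit_det A).mp hA)) i)
      (i.succAbove j)
    rw [mul_apply, Fin.sum_univ_succAbove _ i, one_apply_ne (Fin.succAbove_ne i j).symm] at h
    simpa [vecMul, dotProduct] using eq_neg_of_add_eq_zero_right h
  rw [← smul_vecMul, ← neg_vecMul, ← hrow, vecMul_vecMul, mul_nonsing_inv _ hdet, vecMul_one]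

/-- Leave-one-out residual identity (Rasmussen & Williams eq. (5.12)): for a symmetric
positive definite `A`, deleting the `i`-th row/column gives an invertible matrix `A₋ᵢ`,
`(A⁻¹)ᵢᵢ ≠ 0`, and `yᵢ − aᵢᵀ·A₋ᵢ⁻¹·y₋ᵢ = (A⁻¹y)ᵢ / (A⁻¹)ᵢᵢ`. -/
theorem loo_residual_identity
    (m : ℕ) (A : Matrix (Fin (m + 1)) (Fin (m + 1)) ℝ) (hA : A.PosDef)
    (i : Fin (m + 1)) (y : Fin (m + 1) → ℝ) :
    IsUnit (A.submatrix i.succAbove i.succAbove)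
    ∧ A⁻¹ i i ≠ 0
    ∧ y i - (fun j => A (i.succAbove j) i) ⬝ᵥ
          (A.submatrix i.succAbove i.succAbove)⁻¹.mulVec (fun j => y (i.succAbove j))
        = (A⁻¹.mulVec y) i / (A⁻¹ i i) := by
  have hB := (hA.submatrix (Fin.succAbove_right_injective (p := i))).isUnit
  have hii : A⁻¹ i i ≠ 0 := hA.inv.diag_pos.ne'
  refine ⟨hB, hii, ?_⟩
  have hsymm : (fun j => A (i.succAbove j) i) = fun j => A i (i.succAbove j) := by
    funext j
    simpa using hA.isHermitian.apply i (i.succAbove j)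
  have hexpand : (A⁻¹ *ᵥ y) i = A⁻¹ i i * y i +
      (fun j => A⁻¹ i (i.succAbove j)) ⬝ᵥ fun j => y (i.succAbove j) :=
    Fin.sum_univ_succAbove _ i
  rw [eq_div_iff hii, hexpand, inv_row_succAbove hA.isUnit i hB, hsymm, neg_dotProduct,
    smul_dotProduct, dotProduct_mulVec, smul_eq_mul]
  ring
end

section
/- Let n ≥ 1, let a, b : {1,…,n} → ℝ, and define for each y ∈ ℝ the p-value p(y) = |{i ∈ {1,…,n} : |a_i + b_i·y| ≥ |a_n + b_n·y|}| / n. Let J ⊆ ℝ be a preconnected set (e.g., an open interval) such that for every y ∈ J and every i ∈ {1,…,n−1}, |a_i + b_i·y| ≠ |a_n + b_n·y|. Then p is constant on J. -/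
/-- Two continuous functions that never agree on a preconnected set keep their order there. -/
theorem IsPreconnected.le_of_le_of_forall_ne {X α : Type*} [TopologicalSpace X]
    [LinearOrder α] [TopologicalSpace α] [OrderClosedTopology α] {s : Set X}
    (hs : IsPreconnected s) {f g : X → α} (hf : ContinuousOn f s) (hg : ContinuousOn g s)
    (hne : ∀ x ∈ s, f x ≠ g x) {x y : X} (hx : x ∈ s) (hy : y ∈ s) (hle : f x ≤ g x) :
    f y ≤ g y := by
  by_contra! hlt
  obtain ⟨w, hw, heq⟩ := hs.intermediate_value₂ hx hy hf hg hle hlt.le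
  exact hne w hw heq

/-- The conformal p-value `p(y) = |{i : |aᵢ + bᵢ·y| ≥ |aₙ + bₙ·y|}| / n` is constant on
any preconnected set `J` on which no crossing `|aᵢ + bᵢ·y| = |aₙ + bₙ·y|` (for `i ≠ n`)
occurs. -/
theorem pvalue_constant_between_crossings
    (n : ℕ) (hn : 1 ≤ n) (a b : Fin n → ℝ)
    (p : ℝ → ℝ)
    (hp : ∀ y : ℝ, p y = ((Finset.univ.filter
        (fun i : Fin n =>
          |a ⟨n - 1, by omega⟩ + b ⟨n - 1, by omega⟩ * y| ≤ |a i + b i * y|)).card : ℝ) / n)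
    (J : Set ℝ) (hJ : IsPreconnected J)
    (hnc : ∀ y ∈ J, ∀ i : Fin n, i ≠ ⟨n - 1, by omega⟩ →
      |a i + b i * y| ≠ |a ⟨n - 1, by omega⟩ + b ⟨n - 1, by omega⟩ * y|) :
    ∀ y ∈ J, ∀ z ∈ J, p y = p z := by
  intro y hy z hz
  rw [hp, hp]
  congr 3
  ext i
  simp only [Finset.mem_filter_univ]
  by_cases hi : i = ⟨n - 1, by omega⟩
  · simp [hi]
  have hcont (j : Fin n) : ContinuousOn (fun x => |a j + b j * x|) J := by fun_prop
  have hne := fun x hx => (hnc x hx i hi).symm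
  exact ⟨hJ.le_of_le_of_forall_ne (hcont _) (hcont i) hne hy hz,
    hJ.le_of_le_of_forall_ne (hcont _) (hcont i) hne hz hy⟩
end

section
/- Let n ≥ 1, let a, b : {1,…,n} → ℝ, define for each y ∈ ℝ the p-value p(y) = |{i ∈ {1,…,n} : |a_i + b_i·y| ≥ |a_n + b_n·y|}| / n, and let δ ∈ ℝ. Then the prediction region {y ∈ ℝ : p(y) > δ} is a finite union of convex subsets of ℝ (i.e., a finite union of intervals, rays, points, or the whole line). -/
/-- The set of points where the absolute value of one affine function of a real variable is bounded
by another affine function is convex. -/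
lemma convex_setOf_abs_affine_le (c d e f : ℝ) : Convex ℝ {y : ℝ | |c + d * y| ≤ e + f * y} := by
  intro x hx y hy s t hs ht hst
  simp only [Set.mem_ofPred_eq, abs_le, smul_eq_mul] at hx hy ⊢
  obtain rfl : t = 1 - s := by linarith
  constructor
  · linear_combination s * hx.1 + (1 - s) * hy.1
  · linear_combination s * hx.2 + (1 - s) * hy.2

/-- The conformal prediction region `{y : p(y) > δ}`, where
`p(y) = |{i : |aᵢ + bᵢ·y| ≥ |aₙ + bₙ·y|}| / n`, is a finite union of convex subsets
of `ℝ` (i.e., of intervals, rays, points, or the whole line). -/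
theorem prediction_region_finite_union_of_convex
    (n : ℕ) (hn : 1 ≤ n) (a b : Fin n → ℝ)
    (p : ℝ → ℝ)
    (hp : ∀ y : ℝ, p y = ((Finset.univ.filter
        (fun i : Fin n =>
          |a ⟨n - 1, by omega⟩ + b ⟨n - 1, by omega⟩ * y| ≤ |a i + b i * y|)).card : ℝ) / n)
    (δ : ℝ) :
    ∃ (k : ℕ) (C : Fin k → Set ℝ),
      (∀ j, Convex ℝ (C j)) ∧ {y : ℝ | δ < p y} = ⋃ j, C j := by
  classical
  set c := a ⟨n - 1, by omega⟩
  set d := b ⟨n - 1, by omega⟩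
  -- `|u| ≤ |v|` holds iff `|u| ≤ v` or `|u| ≤ -v`; the pieces are indexed by the sets of indices
  -- for which the first, respectively the second, alternative is imposed.
  let D : Finset (Fin n) × Finset (Fin n) → Set ℝ := fun q =>
    {y | δ < ((q.1 ∪ q.2).card : ℝ) / n ∧ (∀ i ∈ q.1, |c + d * y| ≤ a i + b i * y) ∧
      ∀ i ∈ q.2, |c + d * y| ≤ -a i + -b i * y}
  have hD : ∀ q, Convex ℝ (D q) := by
    intro q
    simp only [D, Set.ofPred_and, Set.ofPred_forall]
    have hconst : Convex ℝ {_y : ℝ | δ < ((q.1 ∪ q.2).card : ℝ) / n} :=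
      fun _ h _ _ _ _ _ _ _ => h
    exact hconst.inter ((convex_iInter₂ fun i _ => convex_setOf_abs_affine_le ..).inter
      (convex_iInter₂ fun i _ => convex_setOf_abs_affine_le ..))
  have hU : {y : ℝ | δ < p y} = ⋃ q, D q := by
    ext y
    simp only [Set.mem_ofPred_eq, Set.mem_iUnion, hp, D]
    constructor
    · intro h
      refine ⟨(Finset.univ.filter fun i => |c + d * y| ≤ a i + b i * y,
        Finset.univ.filter fun i => |c + d * y| ≤ -a i + -b i * y), ?_, by simp, by simp⟩
      rw [← Finset.filter_or]
      convert h using 6 with i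
      rw [le_abs, neg_add, neg_mul]
    · rintro ⟨q, hq, hP, hN⟩
      refine hq.trans_le ?_
      gcongr
      intro i hi
      rw [Finset.mem_filter_univ, le_abs, neg_add, ← neg_mul]
      exact (Finset.mem_union.1 hi).imp (hP i) (hN i)
  let e := Fintype.equivFin (Finset (Fin n) × Finset (Fin n))
  exact ⟨_, D ∘ e.symm, fun j => hD _, hU.trans (e.symm.surjective.iUnion_comp D).symm⟩
end
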